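/- Let the Euclidean plane ℝ² be coloured in red and blue so that there is no red ℓ₂ and no blue ℓ₅. If A, B, C are three red points forming an equilateral triangle with side length √3 (a congruent copy of 𝔗₃), then there exists a red point D such that the four points A, B, C, D form a congruent copy of the configuration 𝔗₄. -/

import Mathlib

/-- The two colours. -/
inductive Color
  | red
  | blue

/-- The Euclidean plane ℝ². -/
abbrev Plane : Type := EuclideanSpace ℝ (Fin 2)

/-- The point of the plane with coordinates `(x, y)`. -/
noncomputable def pt (x y : ℝ) : Plane := (WithLp.equiv 2 (Fin 2 → ℝ)).symm ![x, y]

/-- There is no red ℓ₂, i.e. no two red points at Euclidean distance 1. -/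
def NoRedL2 (c : Plane → Color) : Prop :=
  ∀ x y : Plane, c x = Color.red → c y = Color.red → dist x y ≠ 1

/-- There is a blue ℓ₅: a point `p` and a unit vector `w` such that
`p, p+w, p+2w, p+3w, p+4w` are all blue. -/
def HasBlueL5 (c : Plane → Color) : Prop :=
  ∃ p w : Plane, ‖w‖ = 1 ∧ ∀ i : Fin 5, c (p + (i : ℝ) • w) = Color.blue

/-- The configuration 𝔗₄: a rhombus of side √3 made of two equilateral
triangles of side √3 glued along an edge. -/
noncomputable def T4 : Set Plane :=
  {pt 0 0, pt (3 / 2) (Real.sqrt 3 / 2), pt (3 / 2) (-(Real.sqrt 3 / 2)), pt 3 0}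

/-- Five consecutive points of a line with unit steps are not all blue. -/
lemma not_blue_of_not_hasBlueL5 {c : Plane → Color} (hblue : ¬ HasBlueL5 c)
    {p p₁ p₂ p₃ p₄ w : Plane} (hw : ‖w‖ = 1) (h₁ : p₁ = p + w) (h₂ : p₂ = p + (2 : ℝ) • w)
    (h₃ : p₃ = p + (3 : ℝ) • w) (h₄ : p₄ = p + (4 : ℝ) • w) :
    ¬ (c p = Color.blue ∧ c p₁ = Color.blue ∧ c p₂ = Color.blue ∧ c p₃ = Color.blue ∧
      c p₄ = Color.blue) := by
  subst h₁ h₂ h₃ h₄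
  rintro ⟨b₀, b₁, b₂, b₃, b₄⟩
  refine hblue ⟨p, w, hw, fun i => ?_⟩
  fin_cases i <;> simpa

/-- In a colouring of the triangular lattice without adjacent red points and without five
consecutive blue points, every red triangle of side `√3` around a lattice point has a red
reflection of one of its vertices in the opposite side. -/
lemma red_reflection_of_lattice (r : ℤ → ℤ → Color)
    (hu : ∀ a b, r a b = Color.red → r (a + 1) b ≠ Color.red)
    (hv : ∀ a b, r a b = Color.red → r a (b + 1) ≠ Color.red)
    (huv : ∀ a b, r a b = Color.red → r (a + 1) (b - 1) ≠ Color.red)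
    (bu : ∀ a b, ¬ (r a b = Color.blue ∧ r (a + 1) b = Color.blue ∧ r (a + 2) b = Color.blue ∧
      r (a + 3) b = Color.blue ∧ r (a + 4) b = Color.blue))
    (bv : ∀ a b, ¬ (r a b = Color.blue ∧ r a (b + 1) = Color.blue ∧ r a (b + 2) = Color.blue ∧
      r a (b + 3) = Color.blue ∧ r a (b + 4) = Color.blue))
    (buv : ∀ a b, ¬ (r a b = Color.blue ∧ r (a + 1) (b - 1) = Color.blue ∧
      r (a + 2) (b - 2) = Color.blue ∧ r (a + 3) (b - 3) = Color.blue ∧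
      r (a + 4) (b - 4) = Color.blue))
    (hA : r 0 0 = Color.red) (hB : r 1 1 = Color.red) (hC : r 2 (-1) = Color.red) :
    r 3 0 = Color.red ∨ r (-1) 2 = Color.red ∨ r 1 (-2) = Color.red := by
  have blue : ∀ {x : Color}, x ≠ Color.red → x = Color.blue := by
    intro x hx
    cases x <;> simp_all
  have left : ∀ a b, r (a + 1) b = Color.red → r a b = Color.blue :=
    fun a b h => blue fun h' => hu a b h' h
  have down : ∀ a b, r a (b + 1) = Color.red → r a b = Color.blue :=
    fun a b h => blue fun h' => hv a b h' h
  by_contra! ⟨h₁, h₂, h₃⟩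
  have a₁ : r (-1) 0 = Color.blue := left (-1) 0 hA
  have a₂ : r 0 (-1) = Color.blue := down 0 (-1) hA
  rcases hx : r (-3) 2 with _ | _
  · have b₁ : r (-2) 1 = Color.blue := blue (huv (-3) 2 hx)
    have c₁ : r 3 (-1) = Color.blue := blue (hu 2 (-1) hC)
    have c₂ : r 3 (-2) = Color.blue := blue (huv 2 (-1) hC)
    have d : r 2 (-3) = Color.red := by
      by_contra h
      exact buv (-2) 1 ⟨b₁, a₁, a₂, blue h₃, blue h⟩
    have d₁ : r 3 (-3) = Color.blue := blue (hu 2 (-3) d)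
    have d₂ : r 3 (-4) = Color.blue := blue (huv 2 (-3) d)
    exact bv 3 (-4) ⟨d₂, d₁, c₂, c₁, blue h₁⟩
  · have b₁ : r 0 2 = Color.blue := blue fun h => huv 0 2 h hB
    have b₂ : r 1 2 = Color.blue := blue (hv 1 1 hB)
    have d : r (-2) 2 = Color.red := by
      by_contra h
      exact bu (-3) 2 ⟨hx, blue h, blue h₂, b₁, b₂⟩
    have d' : r (-2) 1 = Color.red := by
      by_contra h
      exact buv (-3) 2 ⟨hx, blue h, a₁, a₂, blue h₃⟩
    exact hv (-2) 1 d' d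

/-- The inner products of the edge vectors of an equilateral triangle of side `√3`. -/
lemma inner_of_equilateral {P Q S : Plane} (hPQ : dist P Q = Real.sqrt 3)
    (hQS : dist Q S = Real.sqrt 3) (hPS : dist P S = Real.sqrt 3) :
    inner ℝ (Q - P) (Q - P) = (3 : ℝ) ∧ inner ℝ (S - P) (S - P) = (3 : ℝ) ∧
      inner ℝ (Q - P) (S - P) = (3 / 2 : ℝ) := by
  have norm_sq : ∀ {x y : Plane}, dist x y = Real.sqrt 3 → inner ℝ (x - y) (x - y) = (3 : ℝ) := by
    intro x y h
    rw [real_inner_self_eq_norm_sq, ← dist_eq_norm, h, Real.sq_sqrt (by norm_num)]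
  have hQ := norm_sq ((dist_comm Q P).trans hPQ)
  have hS := norm_sq ((dist_comm S P).trans hPS)
  have hD := norm_sq hQS
  refine ⟨hQ, hS, ?_⟩
  rw [← sub_sub_sub_cancel_right Q S P, real_inner_sub_sub_self, hQ, hS] at hD
  linarith

/-- The configuration `T4` can be moved so that its first three points are the vertices of any
given equilateral triangle of side `√3`. -/
lemma exists_isometryEquiv_image_T4 {P Q S : Plane} (hPQ : dist P Q = Real.sqrt 3)
    (hQS : dist Q S = Real.sqrt 3) (hPS : dist P S = Real.sqrt 3) :
    ∃ f : Plane ≃ᵢ Plane, f '' T4 = {P, Q, S, Q + S - P} := by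
  obtain ⟨hQ, hS, hqs⟩ := inner_of_equilateral hPQ hQS hPS
  obtain ⟨q, rfl⟩ : ∃ q, Q = P + q := ⟨Q - P, by abel⟩
  obtain ⟨s, rfl⟩ : ∃ s, S = P + s := ⟨S - P, by abel⟩
  simp only [add_sub_cancel_left] at hQ hS hqs
  set w : Fin 2 → Plane := ![(1 / 3 : ℝ) • (q + s), (Real.sqrt 3)⁻¹ • (q - s)] with hw
  have ho : Orthonormal ℝ w := by
    rw [orthonormal_iff_ite]
    intro i j
    fin_cases i <;> fin_cases j <;>
      simp only [hw, Fin.zero_eta, Fin.mk_one, Matrix.cons_val_zero, Matrix.cons_val_one,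
        inner_add_left, inner_add_right, inner_sub_left, inner_sub_right,
        real_inner_smul_left, real_inner_smul_right, hQ, hS, hqs, real_inner_comm q s,
        Fin.isValue, zero_ne_one, one_ne_zero, if_true, if_false] <;>
      field_simp <;> norm_num
  let b : OrthonormalBasis (Fin 2) ℝ Plane :=
    (basisOfOrthonormalOfCardEqFinrank ho (by simp)).toOrthonormalBasis (by simpa using ho)
  have hb : ∀ x y : ℝ, b.repr.symm (pt x y) =
      (x / 3) • (q + s) + (y / Real.sqrt 3) • (q - s) := by
    intro x y
    rw [← b.sum_repr_symm]
    simp [b, pt, hw, smul_smul, div_eq_mul_inv]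
  refine ⟨b.repr.symm.toIsometryEquiv.trans (IsometryEquiv.addLeft P), ?_⟩
  have hhalf : Real.sqrt 3 / 2 / Real.sqrt 3 = 1 / 2 := by field_simp
  simp only [T4, Set.image_insert_eq, Set.image_singleton, IsometryEquiv.trans_apply,
    LinearIsometryEquiv.coe_toIsometryEquiv, IsometryEquiv.addLeft_apply, hb, neg_div, hhalf]
  congr 1
  · module
  congr 1
  · module
  congr 1
  · module
  congr 1
  module

/-- no red ℓ₂ and no blue ℓ₅; if A, B, C are red points forming an
equilateral triangle of side √3, then there is a red point D such that
A, B, C, D form a congruent copy of 𝔗₄. -/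
theorem stmt_4 (c : Plane → Color) (hred : NoRedL2 c) (hblue : ¬ HasBlueL5 c)
    (A B C : Plane) (hA : c A = Color.red) (hB : c B = Color.red) (hC : c C = Color.red)
    (hAB : dist A B = Real.sqrt 3) (hBC : dist B C = Real.sqrt 3)
    (hAC : dist A C = Real.sqrt 3) :
    ∃ D : Plane, c D = Color.red ∧
      ∃ f : Plane ≃ᵢ Plane, f '' T4 = {A, B, C, D} := by
  obtain ⟨hq, hs, hqs⟩ := inner_of_equilateral hAB hBC hAC
  have norm_eq_one : ∀ x y : ℝ, 3 * (x ^ 2 + x * y + y ^ 2) = 1 →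
      ‖x • (B - A) + y • (C - A)‖ = 1 := by
    intro x y h
    rw [← sq_eq_sq₀ (norm_nonneg _) zero_le_one, ← real_inner_self_eq_norm_sq,
      real_inner_add_add_self]
    simp only [real_inner_smul_left, real_inner_smul_right, hq, hs, hqs]
    linarith
  let u : Plane := (1 / 3 : ℝ) • (B - A) + (1 / 3 : ℝ) • (C - A)
  let v : Plane := (2 / 3 : ℝ) • (B - A) + (-1 / 3 : ℝ) • (C - A)
  have norm_u : ‖u‖ = 1 := norm_eq_one _ _ (by norm_num)
  have norm_v : ‖v‖ = 1 := norm_eq_one _ _ (by norm_num)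
  have norm_uv : ‖u - v‖ = 1 := by
    convert norm_eq_one (-1 / 3) (2 / 3) (by norm_num) using 2
    module
  let g : ℤ → ℤ → Plane := fun a b => A + (a : ℝ) • u + (b : ℝ) • v
  have not_red : ∀ {p q : Plane}, ‖q - p‖ = 1 → c p = Color.red → c q ≠ Color.red :=
    fun h hp hq => hred _ _ hq hp (by rw [dist_eq_norm, h])
  have key := red_reflection_of_lattice (fun a b => c (g a b))
    (fun a b => not_red (by convert norm_u using 2; simp only [g]; push_cast; module))
    (fun a b => not_red (by convert norm_v using 2; simp only [g]; push_cast; module))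
    (fun a b => not_red (by convert norm_uv using 2; simp only [g]; push_cast; module))
    (fun a b => by
      refine not_blue_of_not_hasBlueL5 hblue norm_u ?_ ?_ ?_ ?_ <;>
        simp only [g] <;> push_cast <;> module)
    (fun a b => by
      refine not_blue_of_not_hasBlueL5 hblue norm_v ?_ ?_ ?_ ?_ <;>
        simp only [g] <;> push_cast <;> module)
    (fun a b => by
      refine not_blue_of_not_hasBlueL5 hblue norm_uv ?_ ?_ ?_ ?_ <;>
        simp only [g] <;> push_cast <;> module)
    (by convert hA using 2; simp only [g]; push_cast; module)
    (by convert hB using 2; simp only [g, u, v]; push_cast; module)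
    (by convert hC using 2; simp only [g, u, v]; push_cast; module)
  have hD₁ : g 3 0 = B + C - A := by simp only [g, u, v]; push_cast; module
  have hD₂ : g (-1) 2 = A + B - C := by simp only [g, u, v]; push_cast; module
  have hD₃ : g 1 (-2) = A + C - B := by simp only [g, u, v]; push_cast; module
  simp only [hD₁, hD₂, hD₃] at key
  rcases key with h | h | h
  · exact ⟨_, h, exists_isometryEquiv_image_T4 hAB hBC hAC⟩
  · obtain ⟨f, hf⟩ := exists_isometryEquiv_image_T4 ((dist_comm C A).trans hAC) hAB
      ((dist_comm C B).trans hBC)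
    exact ⟨_, h, f, by rw [hf, Set.insert_comm C A, Set.insert_comm C B]⟩
  · obtain ⟨f, hf⟩ := exists_isometryEquiv_image_T4 ((dist_comm B A).trans hAB) hAC hBC
    exact ⟨_, h, f, by rw [hf, Set.insert_comm B A]⟩
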